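/- arXiv:2605.25028 — 4 statements merged into one kernel-verified Lean document; each statement's English description precedes it below -/
import Mathlib

section
/- Let n ≥ 2, k = 2^n, and let G = (V, E) be a simple undirected graph with V = {1,…,n}. Let P̄_G be the intersection of the projection of P^∅_n onto (y_1,z_1) with the projections P̄^e_n for all e ∈ E. Then the two-dimensional Lebesgue measure of P̄_G equals 2^n·tan(π/2^n) − (2^n − N)·δ, where N is the number of independent sets of G (subsets of V containing no edge of E, including the empty set) and δ := (1/2)·tan(π/2^n)·(1 − cos(π/2^{n−1})). -/
open Real MeasureTheory Matrix

/-- The clockwise rotation matrix by angle `π / 2 ^ j` (this is `R_{j+1}` in 1-based indexing). -/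
noncomputable def rotM (j : ℕ) : Matrix (Fin 2) (Fin 2) ℝ :=
  !![Real.cos (Real.pi / 2 ^ j), Real.sin (Real.pi / 2 ^ j);
     -Real.sin (Real.pi / 2 ^ j), Real.cos (Real.pi / 2 ^ j)]

/-- The reflection with respect to the first axis. -/
def reflM : Matrix (Fin 2) (Fin 2) ℝ := !![1, 0; 0, -1]

/-- The vertex `v_ℓ = sec(π/2^n) (cos((2ℓ+1)π/2^n), sin((2ℓ+1)π/2^n))` of the regular `2^n`-gon. -/
noncomputable def vtx (n ℓ : ℕ) : Fin 2 → ℝ :=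
  (Real.cos (Real.pi / 2 ^ n))⁻¹ •
    ![Real.cos ((2 * ℓ + 1) * Real.pi / 2 ^ n), Real.sin ((2 * ℓ + 1) * Real.pi / 2 ^ n)]

/-- The facet midpoint `w_ℓ = (cos((2ℓ+2)π/2^n), sin((2ℓ+2)π/2^n))`. -/
noncomputable def wpt (n ℓ : ℕ) : Fin 2 → ℝ :=
  ![Real.cos ((2 * ℓ + 2) * Real.pi / 2 ^ n), Real.sin ((2 * ℓ + 2) * Real.pi / 2 ^ n)]

/-- `chainAux n b x i = R^{b_i} R_i ⋯ R^{b_1} R_1 x` (1-based indexing of `b` and `R`). -/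
noncomputable def chainAux (n : ℕ) (b : Fin n → Fin 2) (x : Fin 2 → ℝ) : ℕ → Fin 2 → ℝ
  | 0 => x
  | i + 1 =>
    if h : i < n then
      (reflM ^ ((b ⟨i, h⟩ : Fin 2) : ℕ)) *ᵥ (rotM i *ᵥ chainAux n b x i)
    else chainAux n b x i
/-- The polyhedron `P^∅_n` in the space of pairs `(y, z)` (0-based: `y i` is `y_{i+1}`). -/
def Pempty (n : ℕ) : Set ((Fin (n + 1) → ℝ) × (Fin (n + 1) → ℝ)) :=
  {p | (∀ i : Fin n,
        p.1 i.succ = Real.cos (Real.pi / 2 ^ (i : ℕ)) * p.1 i.castSucc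
            + Real.sin (Real.pi / 2 ^ (i : ℕ)) * p.2 i.castSucc ∧
        p.2 i.succ ≥ -Real.sin (Real.pi / 2 ^ (i : ℕ)) * p.1 i.castSucc
            + Real.cos (Real.pi / 2 ^ (i : ℕ)) * p.2 i.castSucc ∧
        p.2 i.succ ≥ Real.sin (Real.pi / 2 ^ (i : ℕ)) * p.1 i.castSucc
            - Real.cos (Real.pi / 2 ^ (i : ℕ)) * p.2 i.castSucc) ∧
    p.1 (Fin.last n) ≤ 1 ∧
    Real.cos (Real.pi / 2 ^ (n - 1)) * p.1 (Fin.last n)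
        + Real.sin (Real.pi / 2 ^ (n - 1)) * p.2 (Fin.last n) ≤ 1}

/-- The polyhedron `P^e_n` for an edge `e` (0-based indexing of `{1,…,n}` as `Fin n`). -/
def Pe (n : ℕ) (e : Finset (Fin n)) : Set ((Fin (n + 1) → ℝ) × (Fin (n + 1) → ℝ)) :=
  {p | (∀ i : Fin n,
        p.1 i.succ = Real.cos (Real.pi / 2 ^ (i : ℕ)) * p.1 i.castSucc
            + Real.sin (Real.pi / 2 ^ (i : ℕ)) * p.2 i.castSucc ∧
        (if i ∈ e then
          p.2 i.succ = -Real.sin (Real.pi / 2 ^ (i : ℕ)) * p.1 i.castSucc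
              + Real.cos (Real.pi / 2 ^ (i : ℕ)) * p.2 i.castSucc
        else
          p.2 i.succ ≥ -Real.sin (Real.pi / 2 ^ (i : ℕ)) * p.1 i.castSucc
              + Real.cos (Real.pi / 2 ^ (i : ℕ)) * p.2 i.castSucc ∧
          p.2 i.succ ≥ Real.sin (Real.pi / 2 ^ (i : ℕ)) * p.1 i.castSucc
              - Real.cos (Real.pi / 2 ^ (i : ℕ)) * p.2 i.castSucc)) ∧
    Real.cos (Real.pi / 2 ^ n) * p.1 (Fin.last n)
        + Real.sin (Real.pi / 2 ^ n) * p.2 (Fin.last n) ≤ Real.cos (Real.pi / 2 ^ n)}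

/-- Projection of a pair `(y, z)` to the coordinates `(y_1, z_1)`. -/
def proj2 {n : ℕ} (p : (Fin (n + 1) → ℝ) × (Fin (n + 1) → ℝ)) : Fin 2 → ℝ :=
  ![p.1 0, p.2 0]

/-- The regular `2^n`-gon `Q_{2^n}`, as the convex hull of its vertices. -/
def Qgon (n : ℕ) : Set (Fin 2 → ℝ) :=
  convexHull ℝ {x | ∃ ℓ < 2 ^ n, x = vtx n ℓ}

/-- The triangle `Δ_ℓ` spanned by `w_{ℓ-1}`, `v_ℓ` and `w_ℓ` (indices mod `2^n`). -/
def tri (n ℓ : ℕ) : Set (Fin 2 → ℝ) :=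
  convexHull ℝ {wpt n (ℓ + 2 ^ n - 1), vtx n ℓ, wpt n ℓ}

/-- First coordinate of the clockwise rotation of `x` by `π / 2 ^ j`. -/
noncomputable def rotFst (j : ℕ) (x : Fin 2 → ℝ) : ℝ :=
  Real.cos (Real.pi / 2 ^ j) * x 0 + Real.sin (Real.pi / 2 ^ j) * x 1

/-- Second coordinate of the clockwise rotation of `x` by `π / 2 ^ j`. -/
noncomputable def rotSnd (j : ℕ) (x : Fin 2 → ℝ) : ℝ :=
  -Real.sin (Real.pi / 2 ^ j) * x 0 + Real.cos (Real.pi / 2 ^ j) * x 1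

/-- Rotate by `π / 2 ^ j` clockwise, then fold onto the upper half plane. -/
noncomputable def foldStep (j : ℕ) (x : Fin 2 → ℝ) : Fin 2 → ℝ := ![rotFst j x, |rotSnd j x|]

/-- The first `j` folding steps applied to `x`. -/
noncomputable def foldIter : ℕ → (Fin 2 → ℝ) → Fin 2 → ℝ
  | 0, x => x
  | j + 1, x => foldStep j (foldIter j x)

/-- The steps among the first `j` at which the folding of `x` really reflects. -/
noncomputable def flips (j : ℕ) (x : Fin 2 → ℝ) : Finset ℕ :=
  (Finset.range j).filter fun i => rotSnd i (foldIter i x) < 0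

/-- The linear functional with normal direction at angle `θ`. -/
noncomputable def dir (θ : ℝ) (x : Fin 2 → ℝ) : ℝ := Real.cos θ * x 0 + Real.sin θ * x 1

/-- The sector of angles `[0, 2π / 2 ^ j]`. -/
def sector : ℕ → Set (Fin 2 → ℝ)
  | 0 => Set.univ
  | j + 1 => {x | 0 ≤ x 1 ∧ Real.cos (Real.pi / 2 ^ j) * x 1 ≤ Real.sin (Real.pi / 2 ^ j) * x 0}

lemma pi_div_two_pow_pos (j : ℕ) : 0 < Real.pi / 2 ^ j := by positivity

lemma pi_div_two_pow_le (j : ℕ) : Real.pi / 2 ^ j ≤ Real.pi :=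
  div_le_self Real.pi_pos.le (one_le_pow₀ (by norm_num))

lemma pi_div_two_pow_succ (j : ℕ) : Real.pi / 2 ^ (j + 1) = Real.pi / 2 ^ j / 2 := by
  rw [pow_succ]; field_simp

lemma two_mul_pi_div_two_pow_succ (j : ℕ) : 2 * (Real.pi / 2 ^ (j + 1)) = Real.pi / 2 ^ j := by
  rw [pi_div_two_pow_succ]; ring

lemma sin_pi_div_two_pow_nonneg (j : ℕ) : 0 ≤ Real.sin (Real.pi / 2 ^ j) :=
  Real.sin_nonneg_of_nonneg_of_le_pi (pi_div_two_pow_pos j).le (pi_div_two_pow_le j)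

lemma cos_pi_div_two_pow_succ_nonneg (j : ℕ) : 0 ≤ Real.cos (Real.pi / 2 ^ (j + 1)) := by
  have h := pi_div_two_pow_pos (j + 1)
  have h' := pi_div_two_pow_le j
  have h2 := pi_div_two_pow_succ j
  exact Real.cos_nonneg_of_neg_pi_div_two_le_of_le (by linarith) (by linarith)

lemma sin_pi_div_two_pow_succ_pos (j : ℕ) : 0 < Real.sin (Real.pi / 2 ^ (j + 1)) := by
  have h := pi_div_two_pow_pos (j + 1)
  have h' := pi_div_two_pow_le j
  have h2 := pi_div_two_pow_succ j
  exact Real.sin_pos_of_pos_of_lt_pi h (by linarith [Real.pi_pos])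

lemma dir_rot (j : ℕ) (σ θ : ℝ) (hσ : σ = 1 ∨ σ = -1) (x : Fin 2 → ℝ) :
    dir (Real.pi / 2 ^ j + σ * θ) x
      = Real.cos θ * rotFst j x + Real.sin θ * (σ * rotSnd j x) := by
  unfold dir rotFst rotSnd
  rw [Real.cos_add, Real.sin_add]
  rcases hσ with rfl | rfl
  · rw [one_mul]; ring
  · rw [neg_one_mul, Real.cos_neg, Real.sin_neg]; ring

lemma exists_angles {ε : ℝ} (hε : 0 ≤ ε) {σ : ℕ → ℝ} (hσ : ∀ i, σ i = 1 ∨ σ i = -1) (n : ℕ) (t : ℝ)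
    (h1 : ε ≤ t) (h2 : t ≤ 2 * (Real.pi / 2 ^ n) - ε) :
    ∃ θ : ℕ → ℝ, θ n = t ∧ (∀ i < n, θ i = Real.pi / 2 ^ i + σ i * θ (i + 1)) ∧
      ∀ i ≤ n, ε ≤ θ i ∧ θ i ≤ 2 * (Real.pi / 2 ^ i) - ε := by
  induction n generalizing t with
  | zero =>
    refine ⟨fun _ => t, rfl, by simp, fun i hi => ?_⟩
    obtain rfl : i = 0 := by omega
    exact ⟨h1, h2⟩
  | succ n ih =>
    rw [two_mul_pi_div_two_pow_succ] at h2
    have hb : ε ≤ Real.pi / 2 ^ n + σ n * t ∧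
        Real.pi / 2 ^ n + σ n * t ≤ 2 * (Real.pi / 2 ^ n) - ε := by
      rcases hσ n with h | h <;> rw [h] <;> constructor <;> linarith
    obtain ⟨θ, hθ, hrec, hrange⟩ := ih _ hb.1 hb.2
    refine ⟨Function.update θ (n + 1) t, by simp, fun i hi => ?_, fun i hi => ?_⟩
    · rw [Function.update_of_ne (by omega)]
      rcases Nat.lt_succ_iff_lt_or_eq.mp hi with h | rfl
      · rw [Function.update_of_ne (by omega)]
        exact hrec i h
      · simpa using hθ
    · rcases Nat.le_succ_iff.mp hi with h | rfl
      · rw [Function.update_of_ne (by omega)]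
        exact hrange i h
      · rw [two_mul_pi_div_two_pow_succ]
        simpa using ⟨h1, h2⟩

lemma dir_le_of_chain {n : ℕ} {σ θ : ℕ → ℝ} {p : ℕ → Fin 2 → ℝ}
    (hσ : ∀ i, σ i = 1 ∨ σ i = -1)
    (hθ : ∀ i < n, θ i = Real.pi / 2 ^ i + σ i * θ (i + 1))
    (hsin : ∀ i < n, 0 ≤ Real.sin (θ (i + 1)))
    (h0 : ∀ i < n, p (i + 1) 0 = rotFst i (p i))
    (h1 : ∀ i < n, σ i * rotSnd i (p i) ≤ p (i + 1) 1) :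
    dir (θ 0) (p 0) ≤ dir (θ n) (p n) := by
  induction n with
  | zero => rfl
  | succ n ih =>
    refine (ih (fun i hi => hθ i (by omega)) (fun i hi => hsin i (by omega))
      (fun i hi => h0 i (by omega)) (fun i hi => h1 i (by omega))).trans ?_
    rw [hθ n (by omega), dir_rot _ _ _ (hσ n), dir, h0 n (by omega)]
    gcongr
    · exact hsin n (by omega)
    · exact h1 n (by omega)

lemma dir_eq_of_chain {n : ℕ} {σ θ : ℕ → ℝ} {p : ℕ → Fin 2 → ℝ}
    (hσ : ∀ i, σ i = 1 ∨ σ i = -1)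
    (hθ : ∀ i < n, θ i = Real.pi / 2 ^ i + σ i * θ (i + 1))
    (h0 : ∀ i < n, p (i + 1) 0 = rotFst i (p i))
    (h1 : ∀ i < n, p (i + 1) 1 = σ i * rotSnd i (p i)) :
    dir (θ 0) (p 0) = dir (θ n) (p n) := by
  induction n with
  | zero => rfl
  | succ n ih =>
    rw [ih (fun i hi => hθ i (by omega)) (fun i hi => h0 i (by omega))
      (fun i hi => h1 i (by omega)), hθ n (by omega), dir_rot _ _ _ (hσ n), dir,
      h0 n (by omega), h1 n (by omega)]

lemma sin_nonneg_of_angle {ε t : ℝ} {i : ℕ} (hε : 0 ≤ ε) (h1 : ε ≤ t)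
    (h2 : t ≤ 2 * (Real.pi / 2 ^ (i + 1)) - ε) : 0 ≤ Real.sin t := by
  rw [two_mul_pi_div_two_pow_succ] at h2
  have := pi_div_two_pow_le i
  exact Real.sin_nonneg_of_nonneg_of_le_pi (by linarith) (by linarith)

/-- The sign with which step `i` acts on the second coordinate while folding `x`. -/
noncomputable def foldSign (x : Fin 2 → ℝ) (i : ℕ) : ℝ :=
  if rotSnd i (foldIter i x) < 0 then -1 else 1

lemma foldSign_eq (x : Fin 2 → ℝ) (i : ℕ) : foldSign x i = 1 ∨ foldSign x i = -1 := by
  unfold foldSign; split_ifs <;> simp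

lemma foldIter_succ_zero (x : Fin 2 → ℝ) (i : ℕ) :
    foldIter (i + 1) x 0 = rotFst i (foldIter i x) := rfl

lemma foldIter_succ_one (x : Fin 2 → ℝ) (i : ℕ) :
    foldIter (i + 1) x 1 = |rotSnd i (foldIter i x)| := rfl

lemma foldIter_succ_one' (x : Fin 2 → ℝ) (i : ℕ) :
    foldIter (i + 1) x 1 = foldSign x i * rotSnd i (foldIter i x) := by
  rw [foldIter_succ_one, foldSign]
  split_ifs with h
  · rw [abs_of_neg h]; ring
  · rw [abs_of_nonneg (not_lt.mp h), one_mul]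

/-- Among all chains compatible with the folding signs of `x`, folding is optimal. -/
lemma dir_foldIter_le {n : ℕ} {x : Fin 2 → ℝ} {q : ℕ → Fin 2 → ℝ} (hq : q 0 = x)
    (h0 : ∀ i < n, q (i + 1) 0 = rotFst i (q i))
    (h1 : ∀ i < n, foldSign x i * rotSnd i (q i) ≤ q (i + 1) 1)
    {t : ℝ} (ht0 : 0 ≤ t) (ht : t ≤ 2 * (Real.pi / 2 ^ n)) :
    dir t (foldIter n x) ≤ dir t (q n) := by
  obtain ⟨θ, rfl, hθ, hr⟩ := exists_angles le_rfl (foldSign_eq x) n t ht0 (by rwa [sub_zero])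
  have e := dir_eq_of_chain (p := fun i => foldIter i x) (foldSign_eq x) hθ
    (fun i _ => foldIter_succ_zero x i) (fun i _ => foldIter_succ_one' x i)
  rw [← e]
  change dir (θ 0) x ≤ _
  rw [← hq]
  exact dir_le_of_chain (foldSign_eq x) hθ
    (fun i hi => sin_nonneg_of_angle le_rfl (hr (i + 1) hi).1 (hr (i + 1) hi).2) h0 h1

lemma mem_flips {n i : ℕ} {x : Fin 2 → ℝ} :
    i ∈ flips n x ↔ i < n ∧ rotSnd i (foldIter i x) < 0 := by
  classical simp [flips]

/-- The constraints cutting out the regular polygon within the sector of angles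
`[0, 2π / 2 ^ n]`. -/
def kite (n : ℕ) : Set (Fin 2 → ℝ) := {u | u 0 ≤ 1 ∧ dir (2 * (Real.pi / 2 ^ n)) u ≤ 1}

/-- The half plane cutting off a vertex of the regular polygon. -/
def cut (n : ℕ) : Set (Fin 2 → ℝ) :=
  {u | dir (Real.pi / 2 ^ n) u ≤ Real.cos (Real.pi / 2 ^ n)}

lemma mem_proj2_image_iff {n : ℕ} {x : Fin 2 → ℝ}
    {s : Set ((Fin (n + 1) → ℝ) × (Fin (n + 1) → ℝ))} {C : ℕ → (Fin 2 → ℝ) → (Fin 2 → ℝ) → Prop}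
    {T : Set (Fin 2 → ℝ)}
    (hs : ∀ p, p ∈ s ↔ (∀ i : Fin n, C i ![p.1 i.castSucc, p.2 i.castSucc]
      ![p.1 i.succ, p.2 i.succ]) ∧ ![p.1 (Fin.last n), p.2 (Fin.last n)] ∈ T) :
    x ∈ proj2 '' s ↔ ∃ q : ℕ → Fin 2 → ℝ, q 0 = x ∧ (∀ i < n, C i (q i) (q (i + 1))) ∧ q n ∈ T := by
  have eta : ∀ v : Fin 2 → ℝ, ![v 0, v 1] = v := fun v => by
    ext i; fin_cases i <;> rfl
  constructor
  · rintro ⟨p, hp, rfl⟩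
    rw [hs] at hp
    refine ⟨fun i => if h : i < n + 1 then ![p.1 ⟨i, h⟩, p.2 ⟨i, h⟩] else 0, ?_, ?_, ?_⟩
    · simp [proj2]
    · intro i hi
      have := hp.1 ⟨i, hi⟩
      simpa [hi, Nat.lt_succ_of_lt hi] using this
    · simpa [Fin.last] using hp.2
  · rintro ⟨q, rfl, h1, h2⟩
    refine ⟨(fun i => q i 0, fun i => q i 1), ?_, ?_⟩
    · rw [hs]
      refine ⟨fun i => ?_, ?_⟩
      · simpa [eta] using h1 i i.2
      · simpa [eta] using h2
    · simp [proj2, eta]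

lemma mem_proj2_Pempty {n : ℕ} (hn : 2 ≤ n) {x : Fin 2 → ℝ} :
    x ∈ proj2 '' Pempty n ↔ foldIter n x ∈ kite n := by
  have key := mem_proj2_image_iff (x := x) (s := Pempty n)
    (C := fun i u v => v 0 = rotFst i u ∧ |rotSnd i u| ≤ v 1) (T := kite n) (by
      intro p
      obtain ⟨m, rfl⟩ : ∃ m, n = m + 1 := ⟨n - 1, by omega⟩
      simp only [Pempty, Set.mem_ofPred_eq, kite, dir, two_mul_pi_div_two_pow_succ, rotFst, rotSnd,
        abs_le', Nat.add_sub_cancel, ge_iff_le]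
      simp [sub_eq_add_neg, add_comm])
  rw [key]
  constructor
  · rintro ⟨q, hq, h, h2⟩
    have h1 : ∀ i < n, foldSign x i * rotSnd i (q i) ≤ q (i + 1) 1 := fun i hi => by
      refine le_trans ?_ (h i hi).2
      rcases foldSign_eq x i with e | e <;> rw [e]
      · rw [one_mul]; exact le_abs_self _
      · rw [neg_one_mul]; exact neg_le_abs _
    have hpos := (pi_div_two_pow_pos n).le
    have a := dir_foldIter_le hq (fun i hi => (h i hi).1) h1 le_rfl (by linarith)
    have b := dir_foldIter_le hq (fun i hi => (h i hi).1) h1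
      (t := 2 * (Real.pi / 2 ^ n)) (by linarith) le_rfl
    simp only [dir, Real.cos_zero, Real.sin_zero, one_mul, zero_mul, add_zero] at a
    exact ⟨a.trans h2.1, b.trans h2.2⟩
  · intro h
    exact ⟨fun i => foldIter i x, rfl,
      fun i _ => ⟨foldIter_succ_zero x i, (foldIter_succ_one x i).ge⟩, h⟩

lemma abs_foldIter_zero_le {n : ℕ} {x : Fin 2 → ℝ} (h : foldIter n x ∈ kite n) {j : ℕ}
    (hj : j < n) : |foldIter (j + 1) x 0| ≤ 1 := by
  have upper : ∀ j ≤ n, foldIter j x 0 ≤ 1 ∧ dir (2 * (Real.pi / 2 ^ j)) (foldIter j x) ≤ 1 := by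
    intro j hj
    induction hj using Nat.decreasingInduction with
    | self => exact h
    | of_succ j hj ih =>
      have ih := ih.2
      rw [two_mul_pi_div_two_pow_succ, dir, foldIter_succ_zero, foldIter_succ_one] at ih
      have hs := sin_pi_div_two_pow_nonneg j
      have a := dir_rot j 1 (Real.pi / 2 ^ j) (Or.inl rfl) (foldIter j x)
      have b := dir_rot j (-1) (Real.pi / 2 ^ j) (Or.inr rfl) (foldIter j x)
      have c := mul_le_mul_of_nonneg_left (le_abs_self (rotSnd j (foldIter j x))) hs
      have d := mul_le_mul_of_nonneg_left (neg_le_abs (rotSnd j (foldIter j x))) hs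
      constructor
      · have : dir (Real.pi / 2 ^ j + -1 * (Real.pi / 2 ^ j)) (foldIter j x)
            = foldIter j x 0 := by
          simp [dir]
        rw [← this, b]; linarith
      · rw [show 2 * (Real.pi / 2 ^ j) = Real.pi / 2 ^ j + 1 * (Real.pi / 2 ^ j) by ring, a]
        linarith
  refine abs_le.mpr ⟨?_, (upper (j + 1) hj).1⟩
  induction j with
  | zero =>
    have := (upper 1 hj).2
    simp only [dir, pow_one, mul_div_cancel₀ _ (two_ne_zero' ℝ), Real.cos_pi, Real.sin_pi] at this
    linarith
  | succ j ih =>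
    have ih := ih (by omega)
    rw [foldIter_succ_zero, rotFst, foldIter_succ_one]
    have hs := mul_nonneg (sin_pi_div_two_pow_nonneg (j + 1))
      (abs_nonneg (rotSnd j (foldIter j x)))
    have hc := cos_pi_div_two_pow_succ_nonneg j
    have := mul_le_mul_of_nonneg_left ih hc
    linarith [Real.cos_le_one (Real.pi / 2 ^ (j + 1))]

open Classical in
/-- The chain starting at `x` which folds at the steps outside `e` and only rotates at the steps
in `e`. -/
noncomputable def partialFold (e : Set ℕ) (x : Fin 2 → ℝ) : ℕ → Fin 2 → ℝ
  | 0 => x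
  | i + 1 =>
    if i ∈ e then ![rotFst i (partialFold e x i), rotSnd i (partialFold e x i)]
    else foldStep i (partialFold e x i)

lemma mem_proj2_Pe {n : ℕ} {e : Finset (Fin n)} {x : Fin 2 → ℝ} (hx : foldIter n x ∈ kite n) :
    x ∈ proj2 '' Pe n e ↔ (∃ i ∈ e, (i : ℕ) ∈ flips n x) ∨ foldIter n x ∈ cut n := by
  classical
  set e' : Set ℕ := {i | ∃ j ∈ e, (j : ℕ) = i} with he'
  have key := mem_proj2_image_iff (x := x) (s := Pe n e)
    (C := fun i u v => v 0 = rotFst i u ∧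
      if i ∈ e' then v 1 = rotSnd i u else |rotSnd i u| ≤ v 1) (T := cut n) (by
      intro p
      have : ∀ i : Fin n, (i : ℕ) ∈ e' ↔ i ∈ e := fun i => by simp [he', Fin.val_inj]
      simp only [Pe, Set.mem_ofPred_eq, cut, dir, rotFst, rotSnd, this, abs_le', ge_iff_le]
      simp [sub_eq_add_neg, add_comm])
  rw [key]
  have hpos := (pi_div_two_pow_pos n).le
  constructor
  · rintro ⟨q, hq, h, h2⟩
    by_contra! hcon
    obtain ⟨hne, hcut⟩ := hcon
    apply hcut
    have h1 : ∀ i < n, foldSign x i * rotSnd i (q i) ≤ q (i + 1) 1 := fun i hi => by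
      have hh := (h i hi).2
      split_ifs at hh with hie
      · obtain ⟨j, hj, rfl⟩ := hie
        have := hne j hj
        rw [mem_flips, not_and] at this
        rw [foldSign, if_neg (this hi), one_mul, hh]
      · refine le_trans ?_ hh
        rcases foldSign_eq x i with e | e <;> rw [e]
        · rw [one_mul]; exact le_abs_self _
        · rw [neg_one_mul]; exact neg_le_abs _
    exact (dir_foldIter_le hq (fun i hi => (h i hi).1) h1 hpos (by linarith)).trans h2
  · intro h
    by_cases hflip : ∃ i ∈ e, (i : ℕ) ∈ flips n x
    · obtain ⟨i, hie, hi⟩ := hflip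
      obtain ⟨hin, hneg⟩ := mem_flips.mp hi
      replace hi : (i : ℕ) ∈ e' := ⟨i, hie, rfl⟩
      clear hie
      generalize (i : ℕ) = i at hi hin hneg
      set q := partialFold e' x with hq
      have q0 : ∀ i, q (i + 1) 0 = rotFst i (q i) := fun i => by
        rw [hq, partialFold]; split_ifs <;> rfl
      have q1 : ∀ i, q (i + 1) 1 = if i ∈ e' then rotSnd i (q i) else |rotSnd i (q i)| :=
        fun i => by rw [hq, partialFold]; split_ifs <;> rfl
      refine ⟨q, rfl, fun i _ => ⟨q0 i, ?_⟩, ?_⟩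
      · rw [q1]; split_ifs <;> simp
      · obtain ⟨θ, hθn, hθ, hr⟩ := exists_angles hpos (σ := fun i => if i ∈ e' then 1 else
            if rotSnd i (q i) < 0 then -1 else 1) (fun i => by split_ifs <;> simp) n
            (Real.pi / 2 ^ n) le_rfl (by linarith)
        have hσ : ∀ i, (if i ∈ e' then (1 : ℝ) else if rotSnd i (q i) < 0 then -1 else 1) = 1 ∨
            (if i ∈ e' then (1 : ℝ) else if rotSnd i (q i) < 0 then -1 else 1) = -1 :=
          fun i => by split_ifs <;> simp
        have heq := dir_eq_of_chain (p := q) hσ hθ (fun i _ => q0 i) (fun i _ => by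
          rw [q1]
          split_ifs with h1 h2
          · rw [one_mul]
          · rw [abs_of_neg h2]; ring
          · rw [abs_of_nonneg (not_lt.mp h2), one_mul])
        have hle := dir_le_of_chain (n := i) (p := fun i => foldIter i x) hσ
          (fun j hj => hθ j (hj.trans hin))
          (fun j hj => sin_nonneg_of_angle hpos (hr (j + 1) (by omega)).1 (hr (j + 1) (by omega)).2)
          (fun j _ => foldIter_succ_zero x j) (fun j _ => by
            rw [foldIter_succ_one]
            split_ifs
            · rw [one_mul]; exact le_abs_self _
            · rw [neg_one_mul]; exact neg_le_abs _
            · rw [one_mul]; exact le_abs_self _)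
        rw [cut, Set.mem_ofPred_eq, ← hθn, ← heq, hθn]
        refine hle.trans ?_
        rw [hθ i hin, if_pos hi, dir_rot _ _ _ (Or.inl rfl), ← foldIter_succ_zero]
        have hy := abs_foldIter_zero_le hx hin
        obtain ⟨hl, hu⟩ := hr (i + 1) hin
        have hsin := sin_nonneg_of_angle hpos hl hu
        have hcos : |Real.cos (θ (i + 1))| ≤ Real.cos (Real.pi / 2 ^ n) := by
          rw [two_mul_pi_div_two_pow_succ] at hu
          have hpi := pi_div_two_pow_le i
          rw [abs_le']
          constructor
          · exact Real.cos_le_cos_of_nonneg_of_le_pi hpos (by linarith) hl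
          · rw [← Real.cos_pi_sub]
            exact Real.cos_le_cos_of_nonneg_of_le_pi hpos (by linarith) (by linarith)
        have h1 := (le_abs_self _).trans_eq (abs_mul (Real.cos (θ (i + 1))) (foldIter (i + 1) x 0))
        have h2 := mul_le_of_le_one_right (abs_nonneg (Real.cos (θ (i + 1)))) hy
        have h3 := mul_nonpos_of_nonneg_of_nonpos hsin hneg.le
        linarith
    · have hcut := h.resolve_left hflip
      refine ⟨fun i => foldIter i x, rfl, fun i hi => ⟨foldIter_succ_zero x i, ?_⟩, hcut⟩
      split_ifs with hie
      · obtain ⟨j, hj, rfl⟩ := hie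
        have : ¬ rotSnd j (foldIter j x) < 0 := fun hneg =>
          hflip ⟨j, hj, mem_flips.mpr ⟨hi, hneg⟩⟩
        exact (foldIter_succ_one x j).trans (abs_of_nonneg (not_lt.mp this))
      · exact (foldIter_succ_one x i).ge

lemma mem_sector_iff (j : ℕ) (u : Fin 2 → ℝ) :
    u ∈ sector j ↔ foldStep j u ∈ sector (j + 1) := by
  have key : foldStep j u ∈ sector (j + 1) ↔
      |Real.cos (Real.pi / 2 ^ j) * rotSnd j u| ≤ Real.sin (Real.pi / 2 ^ j) * rotFst j u ∨
        j = 0 := by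
    cases j with
    | zero => simp [sector, foldStep]
    | succ j =>
      rw [abs_mul, abs_of_nonneg (cos_pi_div_two_pow_succ_nonneg j)]
      simp [sector, foldStep]
  rw [key]
  cases j with
  | zero => simp [sector]
  | succ j =>
    have hd : Real.pi / 2 ^ j = 2 * (Real.pi / 2 ^ (j + 1)) :=
      (two_mul_pi_div_two_pow_succ j).symm
    simp only [sector, Set.mem_ofPred_eq, hd, Real.cos_two_mul, Real.sin_two_mul, rotFst, rotSnd,
      abs_le, Nat.add_eq_zero_iff, one_ne_zero, and_false, or_false]
    have hs := sin_pi_div_two_pow_succ_pos j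
    have hsq := Real.sin_sq_add_cos_sq (Real.pi / 2 ^ (j + 1))
    set s := Real.sin (Real.pi / 2 ^ (j + 1))
    set c := Real.cos (Real.pi / 2 ^ (j + 1))
    have e1 : s * (c * u 0 + s * u 1) + c * (-s * u 0 + c * u 1) = u 1 := by
      linear_combination u 1 * hsq
    have e2 : s * (c * u 0 + s * u 1) - c * (-s * u 0 + c * u 1)
        = 2 * s * c * u 0 - (2 * c ^ 2 - 1) * u 1 := by
      linear_combination u 1 * hsq
    constructor
    · rintro ⟨h1, h2⟩
      constructor <;> linarith
    · rintro ⟨h1, h2⟩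
      constructor <;> linarith

lemma rotM_mulVec (j : ℕ) (u : Fin 2 → ℝ) : rotM j *ᵥ u = ![rotFst j u, rotSnd j u] := by
  ext i; fin_cases i <;> simp [rotM, Matrix.mulVec, dotProduct, Fin.sum_univ_two, rotFst, rotSnd]

lemma reflM_mulVec (u : Fin 2 → ℝ) : reflM *ᵥ u = ![u 0, -u 1] := by
  ext i; fin_cases i <;> simp [reflM, Matrix.mulVec, dotProduct, Fin.sum_univ_two]

lemma measurePreserving_mulVec {M : Matrix (Fin 2) (Fin 2) ℝ} (hM : |M.det| = 1) :
    MeasurePreserving (fun u => M *ᵥ u) := by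
  have hdet : M.det ≠ 0 := fun h => by simp [h] at hM
  refine ⟨(Matrix.toLin' M).continuous_of_finiteDimensional.measurable, ?_⟩
  have := Real.map_matrix_volume_pi_eq_smul_volume_pi hdet
  rwa [abs_inv, hM, inv_one, ENNReal.ofReal_one, one_smul] at this

lemma abs_det_rotM (j : ℕ) : |(rotM j).det| = 1 := by
  rw [rotM, Matrix.det_fin_two_of, show ∀ a b : ℝ, a * a - b * -b = b ^ 2 + a ^ 2 by intros; ring,
    Real.sin_sq_add_cos_sq, abs_one]

lemma abs_det_reflM : |reflM.det| = 1 := by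
  rw [reflM, Matrix.det_fin_two_of]; norm_num

lemma measurable_rotFst (j : ℕ) : Measurable (rotFst j) := by unfold rotFst; fun_prop

lemma measurable_rotSnd (j : ℕ) : Measurable (rotSnd j) := by unfold rotSnd; fun_prop

lemma measurable_foldStep (j : ℕ) : Measurable (foldStep j) := by
  refine measurable_pi_lambda _ fun i => ?_
  fin_cases i
  · exact measurable_rotFst j
  · exact (measurable_rotSnd j).abs

lemma measurable_dir (θ : ℝ) : Measurable (dir θ) := by unfold dir; fun_prop

lemma measurableSet_sector (j : ℕ) : MeasurableSet (sector j) := by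
  cases j with
  | zero => exact MeasurableSet.univ
  | succ j =>
    exact (measurableSet_le measurable_const (measurable_pi_apply 1)).inter
      (measurableSet_le ((measurable_pi_apply 1).const_mul _) ((measurable_pi_apply 0).const_mul _))

/-- A folding step is two-to-one, up to a null set, and preserves volume on each sheet. -/
lemma volume_foldStep_preimage (j : ℕ) {A B : Set (Fin 2 → ℝ)} (hA : MeasurableSet A)
    (hB : MeasurableSet B) (hA0 : ∀ x ∈ A, 0 ≤ x 1) (hB0 : ∀ x ∈ B, 0 ≤ x 1) :
    volume {u | foldStep j u ∈ if rotSnd j u < 0 then B else A} = volume A + volume B := by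
  have hB' : MeasurableSet (B \ {x | x 1 = 0}) :=
    hB.diff (measurableSet_eq_fun (measurable_pi_apply 1) measurable_const)
  have hset : {u | foldStep j u ∈ if rotSnd j u < 0 then B else A}
      = (fun u => rotM j *ᵥ u) ⁻¹' (A ∪ (fun u => reflM *ᵥ u) ⁻¹' (B \ {x | x 1 = 0})) := by
    ext u
    simp only [Set.mem_ofPred_eq, Set.mem_preimage, Set.mem_union, Set.mem_sdiff, rotM_mulVec,
      reflM_mulVec, foldStep]
    split_ifs with h
    · have hnA : ![rotFst j u, rotSnd j u] ∉ A := fun h' => by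
        have := hA0 _ h'
        simp at this
        linarith
      simp [abs_of_neg h, hnA, h.ne]
    · have hle := not_lt.mp h
      rw [abs_of_nonneg hle]
      simp only [Matrix.cons_val_zero, Matrix.cons_val_one, neg_eq_zero]
      refine ⟨Or.inl, fun h' => h'.resolve_right fun ⟨h1, h2⟩ => ?_⟩
      have := hB0 _ h1
      simp at this
      exact h2 (le_antisymm this hle)
  have hrefl := measurePreserving_mulVec abs_det_reflM
  have hnull : volume {x : Fin 2 → ℝ | x 1 = 0} = 0 := Measure.pi_hyperplane _ 1 0
  rw [hset, (measurePreserving_mulVec (abs_det_rotM j)).measure_preimage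
      (hA.union (hrefl.measurable hB')).nullMeasurableSet,
    measure_union _ (hrefl.measurable hB'), hrefl.measure_preimage hB'.nullMeasurableSet,
    measure_sdiff_null hnull]
  rw [Set.disjoint_left]
  rintro x hx ⟨h1, h2⟩
  have ha := hA0 x hx
  have hb := hB0 _ h1
  rw [Set.mem_ofPred_eq] at h2
  simp only [reflM_mulVec, Matrix.cons_val_one, Matrix.cons_val_fin_one] at hb h2
  exact h2 (by linarith)

lemma flips_succ (n : ℕ) (x : Fin 2 → ℝ) :
    flips (n + 1) x = if rotSnd n (foldIter n x) < 0 then insert n (flips n x) else flips n x := by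
  rw [flips, Finset.range_add_one, Finset.filter_insert, flips]

lemma nonneg_of_mem_sector {j : ℕ} {x : Fin 2 → ℝ} (h : x ∈ sector (j + 1)) : 0 ≤ x 1 := h.1

/-- The volume of a set given through the folded point and the pattern of reflections. -/
lemma volume_foldIter_mem (n : ℕ) {A : Finset ℕ → Set (Fin 2 → ℝ)}
    (hA : ∀ S, MeasurableSet (A S)) :
    volume {x | foldIter n x ∈ A (flips n x)}
      = ∑ S ∈ (Finset.range n).powerset, volume (A S ∩ sector n) := by
  induction n generalizing A with
  | zero => simp [foldIter, flips, sector]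
  | succ n ih =>
    set A' : Finset ℕ → Set (Fin 2 → ℝ) :=
      fun S => {u | foldStep n u ∈ A (if rotSnd n u < 0 then insert n S else S)} with hA'
    have hmeas : ∀ S, MeasurableSet (A' S) := fun S => by
      have : A' S = {u | rotSnd n u < 0}.ite (foldStep n ⁻¹' A (insert n S))
          (foldStep n ⁻¹' A S) := by
        ext u
        by_cases h : rotSnd n u < 0 <;> simp [hA', Set.ite, h]
      rw [this]
      exact (measurableSet_lt (measurable_rotSnd n) measurable_const).ite
        (measurable_foldStep n (hA _)) (measurable_foldStep n (hA _))
    have hstep : {x | foldIter (n + 1) x ∈ A (flips (n + 1) x)}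
        = {x | foldIter n x ∈ A' (flips n x)} := by
      ext x
      simp only [Set.mem_ofPred_eq, flips_succ, hA', foldIter]
    have hvol : ∀ S, volume (A' S ∩ sector n)
        = volume (A S ∩ sector (n + 1)) + volume (A (insert n S) ∩ sector (n + 1)) := fun S => by
      rw [← volume_foldStep_preimage n ((hA _).inter (measurableSet_sector _))
        ((hA _).inter (measurableSet_sector _)) (fun x hx => nonneg_of_mem_sector hx.2)
        (fun x hx => nonneg_of_mem_sector hx.2)]
      congr 1
      ext u
      simp only [hA', Set.mem_inter_iff, Set.mem_ofPred_eq, mem_sector_iff n u]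
      split_ifs <;> rfl
    rw [hstep, ih hmeas, Finset.range_add_one, Finset.sum_powerset_insert Finset.notMem_range_self,
      ← Finset.sum_add_distrib]
    exact Finset.sum_congr rfl fun S _ => hvol S

/-- The area of a triangle with one side on the first axis. -/
lemma volume_triangle {m d b : ℝ} (hmd : 0 < m + d) (hb : 0 ≤ b) :
    volume {x : Fin 2 → ℝ | 0 ≤ x 1 ∧ m * x 1 ≤ x 0 ∧ x 0 ≤ b - d * x 1}
      = ENNReal.ofReal (b ^ 2 / (2 * (m + d))) := by
  set T : Set (ℝ × ℝ) := {p | 0 ≤ p.2 ∧ m * p.2 ≤ p.1 ∧ p.1 ≤ b - d * p.2} with hT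
  have hTm : MeasurableSet T :=
    (measurableSet_le measurable_const measurable_snd).inter
      ((measurableSet_le (by fun_prop) measurable_fst).inter
        (measurableSet_le measurable_fst (by fun_prop)))
  have h1 : {x : Fin 2 → ℝ | 0 ≤ x 1 ∧ m * x 1 ≤ x 0 ∧ x 0 ≤ b - d * x 1}
      = MeasurableEquiv.finTwoArrow ⁻¹' T := rfl
  have hslice : ∀ z : ℝ, volume ((fun y => (y, z)) ⁻¹' T)
      = (Set.Icc 0 (b / (m + d))).indicator (fun z => ENNReal.ofReal (b - (m + d) * z)) z := by
    intro z
    by_cases hz : 0 ≤ z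
    · have : (fun y => (y, z)) ⁻¹' T = Set.Icc (m * z) (b - d * z) := by
        ext y; simp [hT, hz]
      rw [this, Real.volume_Icc]
      by_cases hz' : z ≤ b / (m + d)
      · rw [Set.indicator_of_mem (Set.mem_Icc.mpr ⟨hz, hz'⟩)]
        congr 1; ring
      · rw [Set.indicator_of_notMem (fun h => hz' h.2), ENNReal.ofReal_eq_zero]
        rw [not_le, div_lt_iff₀ hmd] at hz'
        linarith
    · rw [Set.indicator_of_notMem (fun h => hz h.1)]
      have : (fun y => (y, z)) ⁻¹' T = ∅ := by
        ext y; simp [hT, hz]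
      rw [this, measure_empty]
  have hq : 0 ≤ b / (m + d) := div_nonneg hb hmd.le
  rw [h1, (volume_preserving_finTwoArrow ℝ).measure_preimage hTm.nullMeasurableSet,
    Measure.volume_eq_prod, Measure.prod_apply_symm hTm]
  simp_rw [hslice]
  rw [lintegral_indicator measurableSet_Icc, ← ofReal_integral_eq_lintegral_ofReal]
  · rw [integral_Icc_eq_integral_Ioc, ← intervalIntegral.integral_of_le hq,
      intervalIntegral.integral_sub (by simp) (by apply Continuous.intervalIntegrable; fun_prop),
      intervalIntegral.integral_const, intervalIntegral.integral_const_mul, integral_id]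
    congr 1
    simp only [smul_eq_mul]
    field_simp
    ring
  · exact (by fun_prop : Continuous fun z : ℝ => b - (m + d) * z).integrableOn_Icc
  · refine (ae_restrict_iff' measurableSet_Icc).mpr (ae_of_all _ fun z hz => ?_)
    have := (le_div_iff₀ hmd).mp hz.2
    simp only [Pi.zero_apply]
    linarith

lemma volume_foldStep_preimage_self (j : ℕ) {A : Set (Fin 2 → ℝ)} (hA : MeasurableSet A)
    (hA0 : ∀ x ∈ A, 0 ≤ x 1) : volume (foldStep j ⁻¹' A) = 2 * volume A := by
  have := volume_foldStep_preimage j hA hA hA0 hA0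
  simp only [ite_self] at this
  rw [two_mul, ← this]
  rfl

lemma measurableSet_kite (n : ℕ) : MeasurableSet (kite n) :=
  (measurableSet_le (measurable_pi_apply 0) measurable_const).inter
    (measurableSet_le (measurable_dir _) measurable_const)

lemma measurableSet_cut (n : ℕ) : MeasurableSet (cut n) :=
  measurableSet_le (measurable_dir _) measurable_const

lemma cos_pi_div_two_pow_pos {n : ℕ} (hn : 2 ≤ n) : 0 < Real.cos (Real.pi / 2 ^ n) := by
  obtain ⟨m, rfl⟩ : ∃ m, n = m + 1 + 1 := ⟨n - 2, by omega⟩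
  have h := pi_div_two_pow_pos (m + 1 + 1)
  have h1 := pi_div_two_pow_succ (m + 1)
  have h2 := pi_div_two_pow_succ m
  have h3 := pi_div_two_pow_le m
  exact Real.cos_pos_of_mem_Ioo ⟨by linarith [Real.pi_pos], by linarith [Real.pi_pos]⟩

lemma sin_pi_div_two_pow_pos {n : ℕ} (hn : 2 ≤ n) : 0 < Real.sin (Real.pi / 2 ^ n) := by
  obtain ⟨m, rfl⟩ : ∃ m, n = m + 1 := ⟨n - 1, by omega⟩
  exact sin_pi_div_two_pow_succ_pos m

lemma mem_kite_iff (n : ℕ) (u : Fin 2 → ℝ) :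
    u ∈ kite n ↔ dir (Real.pi / 2 ^ n) (foldStep n u) ≤ 1 := by
  have a := dir_rot n 1 (Real.pi / 2 ^ n) (Or.inl rfl) u
  have b := dir_rot n (-1) (Real.pi / 2 ^ n) (Or.inr rfl) u
  have e : u 0 = dir (Real.pi / 2 ^ n + -1 * (Real.pi / 2 ^ n)) u := by simp [dir]
  rw [kite, Set.mem_ofPred_eq, e, b,
    show 2 * (Real.pi / 2 ^ n) = Real.pi / 2 ^ n + 1 * (Real.pi / 2 ^ n) by ring, a]
  have hs := sin_pi_div_two_pow_nonneg n
  simp only [dir, foldStep, Matrix.cons_val_zero, Matrix.cons_val_one, Matrix.cons_val_fin_one]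
  rcases le_total 0 (rotSnd n u) with h | h
  · rw [abs_of_nonneg h]
    have := mul_nonneg hs h
    constructor
    · rintro ⟨h1, h2⟩; linarith
    · intro h; constructor <;> linarith
  · rw [abs_of_nonpos h]
    have := mul_nonpos_of_nonneg_of_nonpos hs h
    constructor
    · rintro ⟨h1, h2⟩; linarith
    · intro h; constructor <;> linarith

lemma volume_kite_inter_sector {n : ℕ} (hn : 2 ≤ n) :
    volume (kite n ∩ sector n) = ENNReal.ofReal (Real.tan (Real.pi / 2 ^ n)) := by
  have hc := cos_pi_div_two_pow_pos hn
  have hs := sin_pi_div_two_pow_pos hn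
  have hset : kite n ∩ sector n
      = foldStep n ⁻¹' ({x | dir (Real.pi / 2 ^ n) x ≤ 1} ∩ sector (n + 1)) := by
    ext u
    simp only [Set.mem_inter_iff, Set.mem_preimage, mem_kite_iff, mem_sector_iff n u,
      Set.mem_ofPred_eq]
  have hsq := Real.sin_sq_add_cos_sq (Real.pi / 2 ^ n)
  rw [hset, volume_foldStep_preimage_self n
    ((measurableSet_le (measurable_dir _) measurable_const).inter (measurableSet_sector _))
    (fun x hx => nonneg_of_mem_sector hx.2), Real.tan_eq_sin_div_cos]
  simp only [dir, sector]
  set s := Real.sin (Real.pi / 2 ^ n)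
  set c := Real.cos (Real.pi / 2 ^ n)
  have htri : {x : Fin 2 → ℝ | c * x 0 + s * x 1 ≤ 1} ∩ {x | 0 ≤ x 1 ∧ c * x 1 ≤ s * x 0}
      = {x | 0 ≤ x 1 ∧ c / s * x 1 ≤ x 0 ∧ x 0 ≤ 1 / c - s / c * x 1} := by
    ext x
    have h1 : c / s * x 1 ≤ x 0 ↔ c * x 1 ≤ s * x 0 := by
      rw [div_mul_eq_mul_div, div_le_iff₀ hs, mul_comm (x 0)]
    have h2 : x 0 ≤ 1 / c - s / c * x 1 ↔ c * x 0 + s * x 1 ≤ 1 := by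
      rw [div_mul_eq_mul_div, ← sub_div, le_div_iff₀ hc, le_sub_iff_add_le, mul_comm (x 0)]
    simp only [Set.mem_inter_iff, Set.mem_ofPred_eq, h1, h2]
    tauto
  rw [htri, volume_triangle (by positivity) (by positivity), ← ENNReal.ofReal_ofNat 2,
    ← ENNReal.ofReal_mul (by norm_num)]
  congr 1
  have : c / s + s / c = 1 / (s * c) := by
    field_simp
    linarith
  rw [this]
  field_simp

lemma volume_kite_inter_cut_inter_sector {n : ℕ} (hn : 2 ≤ n) :
    volume (kite n ∩ cut n ∩ sector n)
      = ENNReal.ofReal (Real.sin (Real.pi / 2 ^ n) * Real.cos (Real.pi / 2 ^ n)) := by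
  have hc := cos_pi_div_two_pow_pos hn
  have hs := sin_pi_div_two_pow_pos hn
  have hsq := Real.sin_sq_add_cos_sq (Real.pi / 2 ^ n)
  have hset : kite n ∩ cut n ∩ sector n
      = foldStep n ⁻¹' ({x | x 0 ≤ Real.cos (Real.pi / 2 ^ n)} ∩ sector (n + 1)) := by
    ext u
    have hcut : u ∈ cut n ↔ foldStep n u 0 ≤ Real.cos (Real.pi / 2 ^ n) := Iff.rfl
    simp only [Set.mem_inter_iff, Set.mem_preimage, mem_kite_iff, mem_sector_iff n u, hcut,
      Set.mem_ofPred_eq]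
    refine ⟨fun h => ⟨h.1.2, h.2⟩, fun ⟨h1, h2⟩ => ⟨⟨?_, h1⟩, h2⟩⟩
    generalize foldStep n u = v at h1 h2
    have h3 := mul_le_mul_of_nonneg_left h2.2 hs.le
    refine le_of_mul_le_mul_left ?_ hc
    rw [dir]
    linear_combination h3 + h1 + v 0 * hsq
  rw [hset, volume_foldStep_preimage_self n
    ((measurableSet_le (measurable_pi_apply 0) measurable_const).inter (measurableSet_sector _))
    (fun x hx => nonneg_of_mem_sector hx.2)]
  simp only [sector]
  set s := Real.sin (Real.pi / 2 ^ n)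
  set c := Real.cos (Real.pi / 2 ^ n)
  have htri : {x : Fin 2 → ℝ | x 0 ≤ c} ∩ {x | 0 ≤ x 1 ∧ c * x 1 ≤ s * x 0}
      = {x | 0 ≤ x 1 ∧ c / s * x 1 ≤ x 0 ∧ x 0 ≤ c - 0 * x 1} := by
    ext x
    have h1 : c / s * x 1 ≤ x 0 ↔ c * x 1 ≤ s * x 0 := by
      rw [div_mul_eq_mul_div, div_le_iff₀ hs, mul_comm (x 0)]
    simp only [Set.mem_inter_iff, Set.mem_ofPred_eq, h1, zero_mul, sub_zero]
    tauto
  rw [htri, volume_triangle (by positivity) hc.le, ← ENNReal.ofReal_ofNat 2,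
    ← ENNReal.ofReal_mul (by norm_num)]
  congr 1
  rw [add_zero]
  field_simp

lemma sum_powerset_range_eq {M : Type*} [AddCommMonoid M] (n : ℕ) (f : Finset ℕ → M) :
    ∑ S ∈ (Finset.range n).powerset, f S
      = ∑ T : Finset (Fin n), f (Tᶜ.map Fin.valEmbedding) := by
  symm
  refine Finset.sum_bij (fun T _ => Tᶜ.map Fin.valEmbedding) (fun T _ => ?_)
    (fun T _ T' _ h => compl_injective (Finset.map_injective _ h)) (fun S hS => ?_)
    (fun _ _ => rfl)
  · rw [Finset.mem_powerset]
    intro i hi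
    obtain ⟨j, -, rfl⟩ := Finset.mem_map.mp hi
    exact Finset.mem_range.mpr j.2
  · refine ⟨(Finset.univ.filter fun i : Fin n => (i : ℕ) ∈ S)ᶜ, Finset.mem_univ _, ?_⟩
    ext i
    rw [compl_compl]
    simp only [Finset.mem_map, Finset.mem_filter_univ, Fin.valEmbedding_apply]
    constructor
    · rintro ⟨j, hj, rfl⟩; exact hj
    · exact fun hi => ⟨⟨i, Finset.mem_range.mp (Finset.mem_powerset.mp hS hi)⟩, hi, rfl⟩

/-- The area of `P̄_G` equals `2^n tan(π/2^n) − (2^n − N) δ`, where `N` is the number of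
independent sets of the graph `G = ({1,…,n}, E)` and
`δ = (1/2) tan(π/2^n) (1 − cos(π/2^{n−1}))`. -/
theorem volume_PbarG (n : ℕ) (hn : 2 ≤ n)
    (E : Finset (Finset (Fin n))) (hE : ∀ e ∈ E, e.card = 2) :
    MeasureTheory.volume ((proj2 '' Pempty n) ∩ ⋂ e ∈ E, proj2 '' Pe n e)
      = ENNReal.ofReal ((2 ^ n : ℝ) * Real.tan (Real.pi / 2 ^ n)
          - ((2 ^ n : ℝ)
              - ((Finset.univ.filter fun S : Finset (Fin n) => ∀ e ∈ E, ¬ e ⊆ S).card : ℝ))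
            * (1 / 2 * Real.tan (Real.pi / 2 ^ n)
                * (1 - Real.cos (Real.pi / 2 ^ (n - 1))))) := by
  classical
  set A : Finset ℕ → Set (Fin 2 → ℝ) := fun S =>
    if ∀ e ∈ E, ∃ i ∈ e, (i : ℕ) ∈ S then kite n else kite n ∩ cut n with hA
  have hset : (proj2 '' Pempty n) ∩ ⋂ e ∈ E, proj2 '' Pe n e
      = {x | foldIter n x ∈ A (flips n x)} := by
    ext x
    rw [Set.mem_inter_iff, Set.mem_iInter₂, mem_proj2_Pempty hn, Set.mem_ofPred_eq, hA]
    dsimp only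
    by_cases hx : foldIter n x ∈ kite n
    · simp only [mem_proj2_Pe hx]
      split_ifs with h
      · exact ⟨fun h => h.1, fun h' => ⟨h', fun e he => Or.inl (h e he)⟩⟩
      · push Not at h
        obtain ⟨e, he, hne⟩ := h
        refine ⟨fun h' => ⟨hx, (h'.2 e he).resolve_left ?_⟩,
          fun h' => ⟨hx, fun _ _ => Or.inr h'.2⟩⟩
        rintro ⟨i, hi, hi'⟩
        exact hne i hi hi'
    · split_ifs <;> simp [hx]
  have hmeas : ∀ S, MeasurableSet (A S) := fun S => by
    simp only [hA]
    split_ifs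
    · exact measurableSet_kite n
    · exact (measurableSet_kite n).inter (measurableSet_cut n)
  have hc := cos_pi_div_two_pow_pos hn
  have hs := sin_pi_div_two_pow_pos hn
  have htan : 0 ≤ Real.tan (Real.pi / 2 ^ n) := by
    rw [Real.tan_eq_sin_div_cos]; positivity
  have hterm : ∀ T : Finset (Fin n), volume (A (Tᶜ.map Fin.valEmbedding) ∩ sector n)
      = ENNReal.ofReal (if ∀ e ∈ E, ¬ e ⊆ T then Real.tan (Real.pi / 2 ^ n)
        else Real.sin (Real.pi / 2 ^ n) * Real.cos (Real.pi / 2 ^ n)) := fun T => by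
    have hiff : (∀ e ∈ E, ∃ i ∈ e, (i : ℕ) ∈ Tᶜ.map Fin.valEmbedding) ↔ ∀ e ∈ E, ¬ e ⊆ T := by
      refine forall₂_congr fun e _ => ?_
      rw [Finset.not_subset]
      simp [Fin.val_inj]
    simp only [hA, hiff]
    split_ifs
    · exact volume_kite_inter_sector hn
    · exact volume_kite_inter_cut_inter_sector hn
  rw [hset, volume_foldIter_mem n hmeas, sum_powerset_range_eq, Finset.sum_congr rfl
    fun T _ => hterm T, ← ENNReal.ofReal_sum_of_nonneg fun T _ => by split_ifs <;> positivity]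
  congr 1
  have hδ : Real.sin (Real.pi / 2 ^ n) * Real.cos (Real.pi / 2 ^ n)
      = Real.tan (Real.pi / 2 ^ n) - 1 / 2 * Real.tan (Real.pi / 2 ^ n)
        * (1 - Real.cos (Real.pi / 2 ^ (n - 1))) := by
    have : Real.pi / 2 ^ (n - 1) = 2 * (Real.pi / 2 ^ n) := by
      rw [← two_mul_pi_div_two_pow_succ, Nat.sub_add_cancel (by omega)]
    rw [this, Real.cos_two_mul, Real.tan_eq_sin_div_cos]
    field_simp
    ring
  have hcard := Finset.card_filter_add_card_filter_not (s := Finset.univ)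
    (fun T : Finset (Fin n) => ∀ e ∈ E, ¬ e ⊆ T)
  rw [Finset.card_univ, Fintype.card_finset, Fintype.card_fin] at hcard
  have hcard' : ((Finset.univ.filter fun T : Finset (Fin n) => ¬ ∀ e ∈ E, ¬ e ⊆ T).card : ℝ)
      = 2 ^ n - ((Finset.univ.filter fun T : Finset (Fin n) => ∀ e ∈ E, ¬ e ⊆ T).card : ℝ) := by
    rw [eq_sub_iff_add_eq, add_comm]
    exact_mod_cast hcard
  rw [Finset.sum_ite, Finset.sum_const, Finset.sum_const, nsmul_eq_mul, nsmul_eq_mul, hcard', hδ]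
  ring
end

section
/- For every integer n ≥ 2, the inequality (1/2)·tan(π/2^n)·(1 − cos(π/2^{n−1})) > 1/2^{3n−3} holds. -/
/-- For every `n ≥ 2`, `(1/2) tan(π/2^n) (1 − cos(π/2^{n−1})) > 1/2^{3n−3}`. -/
theorem delta_gt (n : ℕ) (hn : 2 ≤ n) :
    1 / 2 * Real.tan (Real.pi / 2 ^ n) * (1 - Real.cos (Real.pi / 2 ^ (n - 1)))
      > 1 / 2 ^ (3 * n - 3) := by
  obtain ⟨m, rfl⟩ : ∃ m, n = m + 2 := ⟨n - 2, by omega⟩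
  have hπ := Real.pi_gt_three
  set t : ℝ := 1 / 2 ^ (m + 1) with ht
  have ht0 : 0 < t := by positivity
  have ht1 : t < 1 := by
    rw [ht, div_lt_one (by positivity)]
    exact one_lt_pow₀ one_lt_two (by omega)
  have hx : Real.pi / 2 ^ (m + 2) = Real.pi / 2 * t := by
    rw [ht]; field_simp; ring
  have hy : Real.pi / 2 ^ (m + 2 - 1) = 2 * (Real.pi / 2 * t) := by
    rw [ht, show m + 2 - 1 = m + 1 by omega]; field_simp
  have hr : (1 : ℝ) / 2 ^ (3 * (m + 2) - 3) = t ^ 3 := by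
    rw [ht, show 3 * (m + 2) - 3 = (m + 1) * 3 by omega, pow_mul, div_pow, one_pow]
  rw [hx, hy, hr]
  set x := Real.pi / 2 * t with hxt
  have hx0 : 0 < x := by positivity
  have hx1 : x < Real.pi / 2 := by nlinarith
  have hsin : t ≤ Real.sin x := by
    have h := Real.mul_le_sin hx0.le hx1.le
    rwa [hxt, show 2 / Real.pi * (Real.pi / 2 * t) = t by field_simp] at h
  have htan : t < Real.tan x := by
    have h := Real.lt_tan hx0 hx1
    nlinarith
  have hcos : 1 - Real.cos (2 * x) = 2 * Real.sin x ^ 2 := by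
    rw [Real.cos_two_mul, Real.cos_sq']; ring
  calc t ^ 3 = t * t ^ 2 := by ring
    _ < Real.tan x * t ^ 2 := by gcongr
    _ ≤ Real.tan x * Real.sin x ^ 2 := by
      have := ht0.trans htan
      gcongr
    _ = 1 / 2 * Real.tan x * (1 - Real.cos (2 * x)) := by rw [hcos]; ring
end

section
/- Let n ≥ 2, k = 2^n, and ℓ ∈ {0,…,k−1}. The two-dimensional Lebesgue measure of the triangle Δ_ℓ, the convex hull of the three points w_{ℓ−1}, v_ℓ, and w_ℓ (indices mod k), equals (1/2)·tan(π/2^n)·(1 − cos(π/2^{n−1})). -/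
open Real MeasureTheory Matrix

/-- The area of the standard right triangle with unit legs is `1 / 2`. -/
lemma volume_unit_triangle :
    volume {x : Fin 2 → ℝ | 0 ≤ x 0 ∧ 0 ≤ x 1 ∧ x 0 + x 1 ≤ 1} = ENNReal.ofReal (1 / 2) := by
  set S : Set (ℝ × ℝ) := {p | 0 ≤ p.1 ∧ 0 ≤ p.2 ∧ p.1 + p.2 ≤ 1} with hS
  have hclosed : IsClosed S := by
    refine (isClosed_le continuous_const continuous_fst).inter
      ((isClosed_le continuous_const continuous_snd).inter
        (isClosed_le (continuous_fst.add continuous_snd) continuous_const))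
  have hpre : {x : Fin 2 → ℝ | 0 ≤ x 0 ∧ 0 ≤ x 1 ∧ x 0 + x 1 ≤ 1}
      = MeasurableEquiv.finTwoArrow ⁻¹' S := by
    ext x
    simp [hS]
  have hslice (x : ℝ) : volume (Prod.mk x ⁻¹' S)
      = (Set.Icc (0 : ℝ) 1).indicator (fun x ↦ ENNReal.ofReal (1 - x)) x := by
    by_cases hx : x ∈ Set.Icc (0 : ℝ) 1
    · have : Prod.mk x ⁻¹' S = Set.Icc 0 (1 - x) := by
        ext y
        simp only [hS, Set.mem_preimage, Set.mem_ofPred_eq, Set.mem_Icc]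
        exact ⟨fun h ↦ ⟨h.2.1, by linarith [h.2.2]⟩, fun h ↦ ⟨hx.1, h.1, by linarith [h.2]⟩⟩
      rw [this, Real.volume_Icc, Set.indicator_of_mem hx, sub_zero]
    · have : Prod.mk x ⁻¹' S = ∅ := by
        ext y
        simp only [hS, Set.mem_preimage, Set.mem_ofPred_eq, Set.mem_empty_iff_false, iff_false]
        exact fun h ↦ hx ⟨h.1, by linarith [h.2.1, h.2.2]⟩
      rw [this, measure_empty, Set.indicator_of_notMem hx]
  rw [hpre, (volume_preserving_finTwoArrow ℝ).measure_preimage_equiv, Measure.volume_eq_prod,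
    Measure.prod_apply hclosed.measurableSet]
  simp_rw [hslice]
  rw [lintegral_indicator measurableSet_Icc, ← ofReal_integral_eq_lintegral_ofReal]
  · rw [integral_Icc_eq_integral_Ioc, ← intervalIntegral.integral_of_le zero_le_one,
      intervalIntegral.integral_sub (by simp) (by simp), integral_id]
    norm_num
  · exact (continuous_const.sub continuous_id).continuousOn.integrableOn_Icc
  · filter_upwards [ae_restrict_mem measurableSet_Icc] with x hx
    simpa using hx.2

/-- The triangle with vertices `p`, `q`, `r` is an affine image of the standard right triangle. -/
lemma convexHull_triple_eq_image (p q r : Fin 2 → ℝ) :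
    convexHull ℝ {p, q, r} = (fun x ↦ p + x) ''
      (Matrix.toLin' !![q 0 - p 0, r 0 - p 0; q 1 - p 1, r 1 - p 1] ''
        {x : Fin 2 → ℝ | 0 ≤ x 0 ∧ 0 ≤ x 1 ∧ x 0 + x 1 ≤ 1}) := by
  have hconv : Convex ℝ {x : Fin 2 → ℝ | 0 ≤ x 0 ∧ 0 ≤ x 1 ∧ x 0 + x 1 ≤ 1} := by
    rintro x ⟨hx0, hx1, hx⟩ y ⟨hy0, hy1, hy⟩ a b ha hb hab
    simp only [Set.mem_ofPred_eq, Pi.add_apply, Pi.smul_apply, smul_eq_mul]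
    refine ⟨by positivity, by positivity, ?_⟩
    nlinarith [mul_le_mul_of_nonneg_left hx ha, mul_le_mul_of_nonneg_left hy hb]
  apply Set.Subset.antisymm
  · refine convexHull_min ?_ ((hconv.linear_image _).translate p)
    rintro x (rfl | rfl | rfl)
    · exact ⟨_, ⟨![0, 0], by simp, rfl⟩, by ext i; fin_cases i <;> simp⟩
    · exact ⟨_, ⟨![1, 0], by simp, rfl⟩, by ext i; fin_cases i <;> simp⟩
    · exact ⟨_, ⟨![0, 1], by simp, rfl⟩, by ext i; fin_cases i <;> simp⟩
  · rintro _ ⟨_, ⟨x, ⟨hx0, hx1, hx⟩, rfl⟩, rfl⟩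
    have hmem := (convex_convexHull ℝ {p, q, r}).sum_mem (t := Finset.univ)
      (w := ![1 - x 0 - x 1, x 0, x 1]) (z := ![p, q, r])
      (by
        intro i _
        fin_cases i
        · simp; linarith
        · simpa using hx0
        · simpa using hx1)
      (by simp [Fin.sum_univ_three]; ring)
      (by
        intro i _
        apply subset_convexHull
        fin_cases i <;> simp)
    convert hmem using 1
    ext i
    fin_cases i <;> simp [Fin.sum_univ_three, dotProduct] <;> ring

/-- The shoelace formula for the area of a triangle. -/
lemma volume_convexHull_triple (p q r : Fin 2 → ℝ) :
    volume (convexHull ℝ {p, q, r}) = ENNReal.ofReal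
      (1 / 2 * |(q 0 - p 0) * (r 1 - p 1) - (r 0 - p 0) * (q 1 - p 1)|) := by
  rw [convexHull_triple_eq_image, Set.image_add_left, measure_preimage_add,
    Measure.addHaar_image_linearMap, volume_unit_triangle, LinearMap.det_toLin',
    Matrix.det_fin_two_of, ← ENNReal.ofReal_mul (abs_nonneg _), mul_comm (1 / 2 : ℝ)]

lemma wpt_pred (n ℓ : ℕ) : wpt n (ℓ + 2 ^ n - 1)
    = ![Real.cos (2 * ℓ * Real.pi / 2 ^ n), Real.sin (2 * ℓ * Real.pi / 2 ^ n)] := by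
  have hangle : (2 * ((ℓ + 2 ^ n - 1 : ℕ) : ℝ) + 2) * Real.pi / 2 ^ n
      = 2 * ℓ * Real.pi / 2 ^ n + 2 * Real.pi := by
    have h1 : 1 ≤ ℓ + 2 ^ n := Nat.one_le_two_pow.trans (Nat.le_add_left _ _)
    push_cast [Nat.cast_sub h1]
    field_simp
    ring
  rw [wpt, hangle, Real.cos_add_two_pi, Real.sin_add_two_pi]

/-- The area of the triangle `Δ_ℓ` spanned by `w_{ℓ−1}`, `v_ℓ` and `w_ℓ` equals
`(1/2) tan(π/2^n) (1 − cos(π/2^{n−1}))`. -/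
theorem volume_tri (n : ℕ) (hn : 2 ≤ n) (ℓ : ℕ) (hℓ : ℓ < 2 ^ n) :
    MeasureTheory.volume (tri n ℓ)
      = ENNReal.ofReal (1 / 2 * Real.tan (Real.pi / 2 ^ n)
          * (1 - Real.cos (Real.pi / 2 ^ (n - 1)))) := by
  rw [tri, volume_convexHull_triple, wpt_pred]
  congr 1
  set θ := Real.pi / 2 ^ n with hθ
  set φ := (2 * ℓ + 1) * Real.pi / 2 ^ n with hφ
  have hpow : (4 : ℝ) ≤ 2 ^ n := by
    calc (4 : ℝ) = 2 ^ 2 := by norm_num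
      _ ≤ 2 ^ n := pow_le_pow_right₀ one_le_two hn
  have hθ0 : 0 < θ := by positivity
  have hθ1 : θ < Real.pi / 2 :=
    div_lt_div_of_pos_left Real.pi_pos two_pos (by linarith)
  have hcos : 0 < Real.cos θ := Real.cos_pos_of_mem_Ioo ⟨by linarith, hθ1⟩
  have hsin : 0 < Real.sin θ := Real.sin_pos_of_pos_of_lt_pi hθ0 (by linarith [Real.pi_pos])
  have hprev : 2 * ℓ * Real.pi / 2 ^ n = φ - θ := by rw [hφ, hθ]; ring
  have hnext : (2 * ℓ + 2) * Real.pi / 2 ^ n = φ + θ := by rw [hφ, hθ]; ring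
  have hdouble : Real.pi / 2 ^ (n - 1) = 2 * θ := by
    obtain ⟨m, rfl⟩ : ∃ m, n = m + 1 := ⟨n - 1, by omega⟩
    rw [hθ, Nat.add_sub_cancel, pow_succ]
    field_simp
  rw [hdouble, hprev]
  simp only [vtx, wpt, hnext, ← hθ, ← hφ, Pi.smul_apply, smul_eq_mul, Matrix.cons_val_zero,
    Matrix.cons_val_one, Real.cos_sub, Real.sin_sub, Real.cos_add, Real.sin_add,
    Real.cos_two_mul, Real.tan_eq_sin_div_cos]
  have hdet (c s C D : ℝ) (hc : c ≠ 0) (h : s ^ 2 + c ^ 2 = 1) (H : D ^ 2 + C ^ 2 = 1) :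
      (c⁻¹ * C - (C * c + D * s)) * (D * c + C * s - (D * c - C * s))
        - (C * c - D * s - (C * c + D * s)) * (c⁻¹ * D - (D * c - C * s))
      = s / c * (1 - (2 * c ^ 2 - 1)) := by
    field_simp
    linear_combination (2 * s - 2 * s * c ^ 2) * H
  rw [hdet _ _ _ _ hcos.ne' (Real.sin_sq_add_cos_sq θ) (Real.sin_sq_add_cos_sq φ), abs_of_nonneg,
    mul_assoc]
  exact mul_nonneg (by positivity) (by linarith [Real.cos_sq_le_one θ])
end

section
/- Let m, d ≥ 1, let A ∈ ℤ^{m×d} have rows a_1,…,a_m all nonzero, let b ∈ ℤ^m, and let x ≥ 0. Let μ be the uniform probability measure on [0,1]^d (i.e., d-dimensional Lebesgue measure restricted to the unit cube) and define p(t) := x·∫ max{0, max_{j=1,…,m} (⟨a_j, ξ⟩ − b_j) − t} dμ(ξ). Then for every t ∈ ℝ, p is differentiable at t with derivative p′(t) = (vol(P_t) − 1)·x, where P_t := {ξ ∈ [0,1]^d : Aξ ≤ b + t·e}, vol denotes d-dimensional Lebesgue measure, and e = (1,…,1)^⊤ ∈ ℝ^m. -/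
open MeasureTheory

/-- A level set of a nonzero linear functional is Haar-null. -/
theorem addHaar_linearMap_level_set {E : Type*} [NormedAddCommGroup E] [NormedSpace ℝ E]
    [MeasurableSpace E] [BorelSpace E] [FiniteDimensional ℝ E] (μ : Measure E)
    [μ.IsAddHaarMeasure] (L : E →ₗ[ℝ] ℝ) (hL : L ≠ 0) (c : ℝ) :
    μ {v | L v = c} = 0 := by
  have hset : {v | L v = c} =
      ((AffineSubspace.mk' c (⊥ : Submodule ℝ ℝ)).comap L.toAffineMap : Set E) := by
    ext v
    simp [AffineSubspace.mem_mk', sub_eq_zero]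
  rw [hset]
  refine Measure.addHaar_affineSubspace μ _ fun htop => hL ?_
  have huniv : {v | L v = c} = Set.univ := by rw [hset, htop, AffineSubspace.top_coe]
  have hc : ∀ v, L v = c := fun v => huniv.symm.subset (Set.mem_univ v)
  ext v
  rw [hc v, ← hc 0, map_zero, LinearMap.zero_apply]

/-- The expected excess of `G` over a level `t` has derivative `μ {G ≤ t} - μ Ω`
wherever the level `t` has measure zero. -/
theorem hasDerivAt_integral_max_zero_sub {Ω : Type*} [MeasurableSpace Ω] (μ : Measure Ω)
    [IsFiniteMeasure μ] {G : Ω → ℝ} (hG : Measurable G) (hint : Integrable G μ) (t : ℝ)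
    (hnull : μ {ω | G ω = t} = 0) :
    HasDerivAt (fun τ => ∫ ω, max 0 (G ω - τ) ∂μ)
      (μ.real {ω | G ω ≤ t} - μ.real Set.univ) t := by
  have hS : MeasurableSet {ω | G ω ≤ t} := measurableSet_le hG measurable_const
  have key := hasDerivAt_integral_of_dominated_loc_of_lip (μ := μ) (x₀ := t)
    (F := fun τ ω => max 0 (G ω - τ))
    (F' := fun ω => {ω | G ω ≤ t}.indicator (fun _ => (1 : ℝ)) ω - 1)
    (bound := fun _ => 1) Filter.univ_mem
    (Filter.Eventually.of_forall fun τ => by fun_prop)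
    ((integrable_const 0).sup (hint.sub (integrable_const t)))
    (((measurable_const.indicator hS).sub measurable_const).aestronglyMeasurable)
    (Filter.Eventually.of_forall fun ω => by
      refine LipschitzWith.lipschitzOnWith (LipschitzWith.of_dist_le_mul fun u v => ?_)
      have := abs_max_sub_max_le_abs (G ω - u) (G ω - v) 0
      rw [sub_sub_sub_cancel_left, abs_sub_comm v u, max_comm _ 0, max_comm _ 0] at this
      simpa [Real.dist_eq] using this)
    (integrable_const 1)
    (by
      have hne : ∀ᵐ ω ∂μ, G ω ≠ t := by rw [ae_iff]; simpa using hnull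
      filter_upwards [hne] with ω hω
      rcases lt_or_gt_of_ne hω with h | h
      · have hmem : ω ∈ {ω | G ω ≤ t} := h.le
        rw [Set.indicator_of_mem hmem, sub_self]
        refine (hasDerivAt_const t (0 : ℝ)).congr_of_eventuallyEq ?_
        filter_upwards [lt_mem_nhds h] with τ hτ
        exact max_eq_left (by linarith)
      · have hmem : ω ∉ {ω | G ω ≤ t} := not_le.mpr h
        rw [Set.indicator_of_notMem hmem, zero_sub]
        refine ((hasDerivAt_id t).const_sub (G ω)).congr_of_eventuallyEq ?_
        filter_upwards [gt_mem_nhds h] with τ hτ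
        exact max_eq_right (by change 0 ≤ G ω - τ; linarith))
  refine key.2.congr_deriv ?_
  rw [integral_sub ((integrable_const 1).indicator hS) (integrable_const 1),
    integral_indicator_const _ hS]
  simp

/-- With `μ` the uniform probability measure on the cube `[0,1]^d` and
`p(t) = x ⋅ ∫ max{0, max_j (⟨a_j, ξ⟩ − b_j) − t} dμ(ξ)`, the function `p` is differentiable
at every `t` with `p′(t) = (vol(P_t) − 1) ⋅ x`, where
`P_t = {ξ ∈ [0,1]^d : Aξ ≤ b + t e}`. -/
theorem hasDerivAt_expected_recourse (m d : ℕ) (hm : 1 ≤ m) (hd : 1 ≤ d)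
    (A : Matrix (Fin m) (Fin d) ℤ) (hA : ∀ j, (fun l => A j l) ≠ 0)
    (b : Fin m → ℤ) (x : ℝ) (hx : 0 ≤ x) (t : ℝ) :
    HasDerivAt
      (fun τ : ℝ => x * ∫ ξ in Set.Icc (0 : Fin d → ℝ) 1,
        max 0 ((Finset.univ.sup' (Finset.univ_nonempty_iff.mpr ⟨⟨0, hm⟩⟩)
          fun j : Fin m => (∑ l, (A j l : ℝ) * ξ l) - (b j : ℝ)) - τ))
      (((volume {ξ : Fin d → ℝ | ξ ∈ Set.Icc (0 : Fin d → ℝ) 1 ∧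
          ∀ j, (∑ l, (A j l : ℝ) * ξ l) ≤ (b j : ℝ) + t}).toReal - 1) * x)
      t := by
  have hne : (Finset.univ : Finset (Fin m)).Nonempty :=
    Finset.univ_nonempty_iff.mpr ⟨⟨0, hm⟩⟩
  set G : (Fin d → ℝ) → ℝ := fun ξ => Finset.univ.sup' hne
    fun j : Fin m => (∑ l, (A j l : ℝ) * ξ l) - (b j : ℝ) with hGdef
  have hGc : Continuous G :=
    Continuous.finset_sup'_apply hne fun j _ => by fun_prop
  have hnull : volume {ξ | G ξ = t} = 0 := by
    refine measure_mono_null (t := ⋃ j : Fin m,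
      {ξ : Fin d → ℝ | Fintype.linearCombination ℝ (fun l => (A j l : ℝ)) ξ = b j + t}) ?_ ?_
    · intro ξ hξ
      obtain ⟨j, -, hj⟩ := Finset.exists_mem_eq_sup' hne
        fun j : Fin m => (∑ l, (A j l : ℝ) * ξ l) - (b j : ℝ)
      have hG : G ξ = t := hξ
      rw [hGdef] at hG
      refine Set.mem_iUnion.mpr ⟨j, ?_⟩
      simp only [Set.mem_ofPred_eq, Fintype.linearCombination_apply, smul_eq_mul, mul_comm (ξ _)]
      linarith
    · refine measure_iUnion_null fun j => addHaar_linearMap_level_set volume _ (fun h => ?_) _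
      refine hA j (funext fun l => ?_)
      have := LinearMap.congr_fun h (Pi.single l 1)
      simpa [Fintype.linearCombination_apply_single] using this
  have hvol : volume (Set.Icc (0 : Fin d → ℝ) 1) = 1 := by simp [Real.volume_Icc_pi]
  have : IsFiniteMeasure (volume.restrict (Set.Icc (0 : Fin d → ℝ) 1)) :=
    ⟨by simp [hvol]⟩
  have key := (hasDerivAt_integral_max_zero_sub (volume.restrict (Set.Icc (0 : Fin d → ℝ) 1))
    hGc.measurable (hGc.continuousOn.integrableOn_compact isCompact_Icc) t
    (Measure.absolutelyContinuous_of_le Measure.restrict_le_self hnull)).const_mul x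
  refine key.congr_deriv ?_
  have hset : {ξ | G ξ ≤ t} ∩ Set.Icc (0 : Fin d → ℝ) 1 =
      {ξ : Fin d → ℝ | ξ ∈ Set.Icc (0 : Fin d → ℝ) 1 ∧
        ∀ j, (∑ l, (A j l : ℝ) * ξ l) ≤ (b j : ℝ) + t} := by
    ext ξ
    simp only [hGdef, Set.mem_inter_iff, Set.mem_ofPred_eq, Finset.sup'_le_iff, Finset.mem_univ,
      forall_const, sub_le_iff_le_add']
    exact and_comm
  rw [measureReal_def, measureReal_def, Measure.restrict_apply_univ, hvol,
    Measure.restrict_apply (measurableSet_le hGc.measurable measurable_const), hset,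
    ENNReal.toReal_one, mul_comm]
end
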